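/- arXiv:1411.1038 — 5 statements merged into one kernel-verified Lean document; each statement's English description precedes it below -/
import Mathlib

section
/- Gallai's Theorem (coloring version): For every positive integer k, every coloring f : ℝ² → Fin k of the Euclidean plane with k colors, and every finite set X ⊆ ℝ², there exist a vector a ∈ ℝ² and a real scalar λ > 0 such that the homothetic image a + λ • X = {a + λ·x : x ∈ X} is monochromatic, i.e., f is constant on a + λ • X. -/
/-- Gallai's Theorem (coloring version): for every positive `k`, every `k`-coloring of the
plane, and every finite set `X ⊆ ℝ²`, there is a homothetic image `a + λ • X` (with `λ > 0`)
on which the coloring is constant. -/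
theorem gallai_coloring (k : ℕ) (hk : 0 < k) (f : ℝ × ℝ → Fin k)
    (X : Set (ℝ × ℝ)) (hX : X.Finite) :
    ∃ (a : ℝ × ℝ) (l : ℝ), 0 < l ∧
      ∀ x ∈ X, ∀ y ∈ X, f (a + l • x) = f (a + l • y) := by
  obtain ⟨n, hn, b, c, h⟩ :=
    Combinatorics.exists_mono_homothetic_copy (M := ℝ × ℝ) hX.toFinset f
  have key : ∀ x ∈ X, f (b + (n : ℝ) • x) = c := by
    intro x hx
    rw [add_comm, Nat.cast_smul_eq_nsmul]
    exact h x (hX.mem_toFinset.mpr hx)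
  exact ⟨b, n, Nat.cast_pos.mpr hn, fun x hx y hy => (key x hx).trans (key y hy).symm⟩
end

section
/- Gallai's Theorem (finite version): For every finite set X ⊆ ℝ² and every positive integer k, there exists a finite set Y ⊆ ℝ² such that for every coloring f : Y → Fin k there exist a vector a ∈ ℝ² and a real scalar λ > 0 with a + λ • X ⊆ Y and f constant on a + λ • X. -/
/-- Gallai's Theorem (finite version): for every finite `X ⊆ ℝ²` and positive `k`, there is a
finite set `Y ⊆ ℝ²` such that every `k`-coloring of `Y` admits a monochromatic homothetic
image `a + λ • X ⊆ Y` with `λ > 0`. -/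
theorem gallai_finite (X : Set (ℝ × ℝ)) (hX : X.Finite) (k : ℕ) (hk : 0 < k) :
    ∃ Y : Set (ℝ × ℝ), Y.Finite ∧
      ∀ f : ℝ × ℝ → Fin k,
        ∃ (a : ℝ × ℝ) (l : ℝ), 0 < l ∧
          (fun x => a + l • x) '' X ⊆ Y ∧
          ∀ x ∈ X, ∀ y ∈ X, f (a + l • x) = f (a + l • y) := by
  classical
  have : Finite X := hX
  obtain ⟨ι, _inst, hι⟩ := Combinatorics.Line.exists_mono_in_high_dimension X (Fin k)
  refine ⟨Set.range fun v : ι → X => ∑ i, (v i : ℝ × ℝ), Set.finite_range _, fun f => ?_⟩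
  obtain ⟨l, c, hl⟩ := hι fun v => f (∑ i, (v i : ℝ × ℝ))
  let s : Finset ι := Finset.univ.filter fun i => l.idxFun i = none
  let b : ℝ × ℝ := ∑ i ∈ sᶜ, ((l.idxFun i).map Subtype.val).getD 0
  have key : ∀ x : X, b + (s.card : ℝ) • (x : ℝ × ℝ) = ∑ i, (l x i : ℝ × ℝ) := by
    intro x
    rw [← Finset.sum_add_sum_compl s, add_comm]
    congr 1
    · rw [Nat.cast_smul_eq_nsmul, ← Finset.sum_const]
      apply Finset.sum_congr rfl
      intro i hi
      rw [l.apply_none _ _ (Finset.mem_filter.mp hi).2]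
    · apply Finset.sum_congr rfl
      intro i hi
      have hi' : l.idxFun i ≠ none := by simpa [s] using hi
      obtain ⟨y, hy⟩ := Option.ne_none_iff_exists.mp hi'
      simp [Combinatorics.Line.apply_def, ← hy]
  refine ⟨b, s.card, ?_, ?_, ?_⟩
  · obtain ⟨i, hi⟩ := l.proper
    exact_mod_cast Finset.card_pos.mpr ⟨i, by simp [s, hi]⟩
  · rintro _ ⟨x, hx, rfl⟩
    exact ⟨l ⟨x, hx⟩, (key ⟨x, hx⟩).symm⟩
  · intro x hx y hy
    have h1 := key ⟨x, hx⟩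
    have h2 := key ⟨y, hy⟩
    simp only at h1 h2
    rw [h1, h2]
    exact (hl ⟨x, hx⟩).trans (hl ⟨y, hy⟩).symm
end

section
/- Inductive step δ(n,k,m) and δ(n,k^{|D|},1) ⟹ δ(n,k,m+1): Let n ≥ 3, let e₀ = (0,0), e₁, ..., e_{n−1} be distinct points of ℝ², write S_j = {e₀, ..., e_{j−1}}, and let k, m be positive integers. Suppose D ⊆ ℝ² is a finite set such that for every coloring f of D with k colors there exist a ∈ ℝ² and reals 0 = λ₀ < λ₁ < ... < λ_m such that for all 0 ≤ i < j ≤ m, setting h_{i,j}(v) = a + λ_i·e_{n−1} + (λ_j − λ_i)·v, one has h_{i,j}(S_n) ⊆ D and f constant on h_{i,j}(S_{n−1}). Suppose further that D′ ⊆ ℝ² is a set such that for every coloring of D′ with k^{|D|} colors there exist b ∈ ℝ² and μ₁ > 0 such that, setting g(v) = b + μ₁·v, one has g(S_n) ⊆ D′ and the coloring constant on g(S_{n−1}). Then the complex sum D′ + D = {v + w : v ∈ D′, w ∈ D} has the analogous property with m+1 in place of m: for every coloring f of D′ + D with k colors there exist a′ ∈ ℝ² and reals 0 = λ₀ < λ₁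 < ... < λ_{m+1} such that for all 0 ≤ i < j ≤ m+1, setting h′_{i,j}(v) = a′ + λ_i·e_{n−1} + (λ_j − λ_i)·v, one has h′_{i,j}(S_n) ⊆ D′ + D and f constant on h′_{i,j}(S_{n−1}). -/
open Pointwise

/-- `S_j = {e₀, …, e_{j−1}}`. -/
def Sset (e : ℕ → ℝ × ℝ) (j : ℕ) : Set (ℝ × ℝ) := e '' {i | i < j}

/-- The δ-property `δ(n,k,m)` of a set `D ⊆ ℝ²`: for every `k`-coloring `f` of `D` there are
`a ∈ ℝ²` and scalars `0 = λ₀ < λ₁ < ⋯ < λ_m` such that for all `0 ≤ i < j ≤ m`, the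
homothety `h_{i,j}(v) = a + λ_i • e_{n−1} + (λ_j − λ_i) • v` maps `S_n` into `D` and `f`
is constant on `h_{i,j}(S_{n−1})`. -/
def deltaProp (e : ℕ → ℝ × ℝ) (n k m : ℕ) (D : Set (ℝ × ℝ)) : Prop :=
  ∀ f : ℝ × ℝ → Fin k, ∃ (a : ℝ × ℝ) (lam : ℕ → ℝ),
    lam 0 = 0 ∧ (∀ i < m, lam i < lam (i + 1)) ∧
    ∀ i j : ℕ, i < j → j ≤ m →
      ((fun v => a + lam i • e (n - 1) + (lam j - lam i) • v) '' Sset e n ⊆ D ∧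
       ∀ x ∈ Sset e (n - 1), ∀ y ∈ Sset e (n - 1),
         f (a + lam i • e (n - 1) + (lam j - lam i) • x) =
           f (a + lam i • e (n - 1) + (lam j - lam i) • y))

/-- Inductive step `δ(n,k,m)` and `δ(n,k^{|D|},1)` imply `δ(n,k,m+1)` for the complex sum
`D′ + D`. -/
theorem gallai_step_delta_succ (e : ℕ → ℝ × ℝ) (he0 : e 0 = 0)
    (n : ℕ) (hn : 3 ≤ n) (hinj : Set.InjOn e {i | i < n})
    (k m : ℕ) (hk : 0 < k) (hm : 0 < m)
    (D : Set (ℝ × ℝ)) (hDfin : D.Finite) (hD : deltaProp e n k m D)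
    (D' : Set (ℝ × ℝ)) (hD' : deltaProp e n (k ^ D.ncard) 1 D') :
    deltaProp e n k (m + 1) (D' + D) := by
  intro f
  haveI : Fintype D := hDfin.fintype
  classical
  have hcard : Fintype.card (D → Fin k) = k ^ D.ncard := by
    rw [Fintype.card_fun, Fintype.card_fin, ← Nat.card_eq_fintype_card, Nat.card_coe_set_eq]
  let E : (D → Fin k) ≃ Fin (k ^ D.ncard) := Fintype.equivFinOfCardEq hcard
  obtain ⟨b, mu, hmu0, hmu, hb⟩ := hD' (fun x => E (fun w => f (x + w)))
  obtain ⟨hbD, hbc⟩ := hb 0 1 (by norm_num) le_rfl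
  have hmu1 := hmu 0 (by norm_num)
  simp only [hmu0, zero_smul, add_zero, sub_zero, zero_add] at hbD hbc hmu1
  have hbS : ∀ v ∈ Sset e n, b + mu 1 • v ∈ D' := fun v hv => hbD ⟨v, hv, rfl⟩
  have h0n : (0 : ℝ × ℝ) ∈ Sset e n := ⟨0, by simp; omega, he0⟩
  have h0n' : (0 : ℝ × ℝ) ∈ Sset e (n - 1) := ⟨0, by simp; omega, he0⟩
  have hlast : e (n - 1) ∈ Sset e n := ⟨n - 1, by simp; omega, rfl⟩
  have hbf : ∀ v ∈ Sset e (n - 1), ∀ w ∈ D, f (b + mu 1 • v + w) = f (b + w) := by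
    intro v hv w hw
    have h := congrFun (E.injective (hbc v hv 0 h0n')) ⟨w, hw⟩
    simpa using h
  have hb0 : b ∈ D' := by simpa using hbS 0 h0n
  have hsub : Sset e (n - 1) ⊆ Sset e n := by
    rintro _ ⟨i, hi, rfl⟩
    exact ⟨i, by simp at hi ⊢; omega, rfl⟩
  obtain ⟨a, lam, hl0, hl, ha⟩ := hD (fun w => f (b + w))
  have key : ∀ i ≤ m,
      (∀ v ∈ Sset e n, a + lam i • e (n - 1) + (lam m - lam i) • v ∈ D) ∧
      ∀ x ∈ Sset e (n - 1), ∀ y ∈ Sset e (n - 1),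
         f (b + (a + lam i • e (n - 1) + (lam m - lam i) • x)) =
           f (b + (a + lam i • e (n - 1) + (lam m - lam i) • y)) := by
    intro i hi
    rcases hi.lt_or_eq with h | rfl
    · exact ⟨fun v hv => (ha i m h le_rfl).1 ⟨v, hv, rfl⟩, (ha i m h le_rfl).2⟩
    · refine ⟨fun v _ => ?_, fun x _ y _ => by simp⟩
      have := (ha 0 i hm le_rfl).1 ⟨e (n - 1), hlast, rfl⟩
      simpa [hl0] using this
  refine ⟨b + a, fun i => if i ≤ m then lam i else lam m + mu 1, by simp [hl0], ?_, ?_⟩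
  · intro i hi
    rcases (Nat.lt_succ_iff.mp hi).lt_or_eq with h | rfl
    · simpa [h.le, Nat.succ_le_of_lt h] using hl i h
    · simpa using hmu1
  · intro i j hij hj
    have him : i ≤ m := by omega
    rcases hj.lt_or_eq with h | rfl
    · have hjm : j ≤ m := by omega
      simp only [him, hjm, if_true]
      obtain ⟨h1, h2⟩ := ha i j hij hjm
      constructor
      · rintro _ ⟨v, hv, rfl⟩
        exact ⟨b, hb0, _, h1 ⟨v, hv, rfl⟩, by simp only [add_assoc]⟩
      · intro x hx y hy
        simpa only [add_assoc] using h2 x hx y hy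
    · have hne : ¬ (m + 1 ≤ m) := by omega
      simp only [him, hne, if_true, if_false]
      obtain ⟨h1, h2⟩ := key i him
      have heq : ∀ v : ℝ × ℝ, b + a + lam i • e (n - 1) + (lam m + mu 1 - lam i) • v =
          (b + mu 1 • v) + (a + lam i • e (n - 1) + (lam m - lam i) • v) := by
        intro v; module
      constructor
      · rintro _ ⟨v, hv, rfl⟩
        exact ⟨_, hbS v hv, _, h1 v hv, (heq v).symm⟩
      · intro x hx y hy
        rw [heq, heq, hbf x hx _ (h1 x (hsub hx)), hbf y hy _ (h1 y (hsub hy))]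
        exact h2 x hx y hy
end

section
/- Final step δ(n,k,k) ⟹ φ(n,k): Let n ≥ 3, let e₀ = (0,0), e₁, ..., e_{n−1} be distinct points of ℝ², write S_j = {e₀, ..., e_{j−1}}, and let k be a positive integer. Suppose D ⊆ ℝ² is a set such that for every coloring f of D with k colors there exist a ∈ ℝ² and reals 0 = λ₀ < λ₁ < ... < λ_k such that for all 0 ≤ i < j ≤ k, setting h_{i,j}(v) = a + λ_i·e_{n−1} + (λ_j − λ_i)·v, one has h_{i,j}(S_n) ⊆ D and f constant on h_{i,j}(S_{n−1}). Then for every coloring f of D with k colors, D contains a monochromatic homothetic image of S_n: there exist c ∈ ℝ² and λ > 0 with c + λ • S_n ⊆ D and f constant on c + λ • S_n. -/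
/-- The homothetic image `a + l • X`. -/
def homImage (a : ℝ × ℝ) (l : ℝ) (X : Set (ℝ × ℝ)) : Set (ℝ × ℝ) :=
  (fun x => a + l • x) '' X

/-- Final step `δ(n,k,k) ⟹ φ(n,k)`: if `D` has the property `δ(n,k,k)`, then under every
`k`-coloring, `D` contains a monochromatic homothetic image of `S_n`. -/
theorem gallai_step_delta_phi (e : ℕ → ℝ × ℝ) (he0 : e 0 = 0)
    (n : ℕ) (hn : 3 ≤ n) (hinj : Set.InjOn e {i | i < n})
    (k : ℕ) (hk : 0 < k)
    (D : Set (ℝ × ℝ)) (hD : deltaProp e n k k D) :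
    ∀ f : ℝ × ℝ → Fin k, ∃ (c : ℝ × ℝ) (l : ℝ), 0 < l ∧
      homImage c l (Sset e n) ⊆ D ∧
      ∀ x ∈ Sset e n, ∀ y ∈ Sset e n, f (c + l • x) = f (c + l • y) := by
  intro f
  obtain ⟨a, lam, h0, hlt, H⟩ := hD f
  have hpig : ∃ i j : ℕ, i < j ∧ j ≤ k ∧
      f (a + lam i • e (n - 1)) = f (a + lam j • e (n - 1)) := by
    obtain ⟨x, y, hxy, hf⟩ := Fintype.exists_ne_map_eq_of_card_lt
      (fun i : Fin (k + 1) => f (a + lam i • e (n - 1))) (by simp)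
    have hne : (x : ℕ) ≠ y := fun h => hxy (Fin.ext h)
    rcases lt_or_gt_of_ne hne with h | h
    · exact ⟨x, y, h, by omega, hf⟩
    · exact ⟨y, x, h, by omega, hf.symm⟩
  obtain ⟨i, j, hij, hjk, hf⟩ := hpig
  have hmono : ∀ m, i < m → m ≤ k → lam i < lam m := by
    intro m him
    induction m, him using Nat.le_induction with
    | base => intro h; exact hlt i (by omega)
    | succ m hm ih => intro h; exact (ih (by omega)).trans (hlt m (by omega))
  obtain ⟨h1, h2⟩ := H i j hij hjk
  refine ⟨a + lam i • e (n - 1), lam j - lam i, sub_pos.2 (hmono j hij hjk), h1, ?_⟩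
  have key : ∀ x ∈ Sset e n, f (a + lam i • e (n - 1) + (lam j - lam i) • x) =
      f (a + lam i • e (n - 1)) := by
    rintro x ⟨t, ht, rfl⟩
    have ht' : t < n := ht
    by_cases htn : t = n - 1
    · subst htn
      rw [hf, add_assoc, ← add_smul, add_sub_cancel]
    · have := h2 (e t) ⟨t, show t < n - 1 by omega, rfl⟩ (e 0) ⟨0, show 0 < n - 1 by omega, rfl⟩
      rw [this, he0, smul_zero, add_zero]
  intro x hx y hy
  rw [key x hx, key y hy]
end

section
/- Existence of δ-sets: Let e₀ = (0,0), e₁, e₂, ... be distinct points of ℝ² and write S_j = {e₀, ..., e_{j−1}}. For all integers n ≥ 3, k ≥ 1, and m ≥ 1, there exists a finite set D ⊆ ℝ² such that for every coloring f of D with k colors there exist a vector a ∈ ℝ² and real scalars 0 = λ₀ < λ₁ < ... < λ_m such that for all 0 ≤ i < j ≤ m, setting h_{i,j}(v) = a + λ_i·e_{n−1} + (λ_j − λ_i)·v for v ∈ ℝ², one has h_{i,j}(S_n) ⊆ D and f constant on h_{i,j}(S_{n−1}). -/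
/-- Finitary Gallai theorem. -/
theorem gallai_finitary (S : Finset (ℝ × ℝ)) (k : ℕ) :
    ∃ D : Set (ℝ × ℝ), D.Finite ∧ ∀ f : ℝ × ℝ → Fin k, ∃ a > 0, ∃ (b : ℝ × ℝ) (c : Fin k),
      ∀ s ∈ S, (a : ℕ) • s + b ∈ D ∧ f (a • s + b) = c := by
  classical
  obtain ⟨ι, _inst, hι⟩ := Combinatorics.Line.exists_mono_in_high_dimension S (Fin k)
  refine ⟨Set.range fun v : ι → S => ∑ i, (v i : ℝ × ℝ), Set.finite_range _, fun f => ?_⟩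
  specialize hι fun v => f <| ∑ i, v i
  obtain ⟨l, c, hl⟩ := hι
  set s : Finset ι := {i | l.idxFun i = none} with hs
  refine ⟨s.card, Finset.card_pos.mpr ⟨l.proper.choose, ?_⟩, ∑ i ∈ sᶜ, ((l.idxFun i).map ?_).getD 0,
    c, ?_⟩
  · rw [hs, Finset.mem_filter]
    exact ⟨Finset.mem_univ _, l.proper.choose_spec⟩
  · exact fun m => m
  intro x xs
  have key : s.card • x + ∑ i ∈ sᶜ, ((l.idxFun i).map (fun m : S => (m : ℝ × ℝ))).getD 0
      = ∑ i, ((l ⟨x, xs⟩ i : S) : ℝ × ℝ) := by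
    rw [← Finset.sum_add_sum_compl s]
    congr 1
    · rw [← Finset.sum_const]
      apply Finset.sum_congr rfl
      intro i hi
      rw [hs, Finset.mem_filter] at hi
      rw [l.apply_none _ _ hi.right]
    · apply Finset.sum_congr rfl
      intro i hi
      rw [hs, Finset.compl_filter, Finset.mem_filter] at hi
      obtain ⟨y, hy⟩ := Option.ne_none_iff_exists.mp hi.right
      simp [← hy]
  constructor
  · exact ⟨l ⟨x, xs⟩, key.symm⟩
  · rw [← hl ⟨x, xs⟩]
    exact congrArg f key

/-- Existence of δ-sets: for all `n ≥ 3`, `k ≥ 1`, `m ≥ 1` there is a finite `D ⊆ ℝ²`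
with property `δ(n,k,m)`. -/
theorem gallai_delta_exists (e : ℕ → ℝ × ℝ) (he0 : e 0 = 0)
    (hinj : Function.Injective e)
    (n k m : ℕ) (hn : 3 ≤ n) (hk : 1 ≤ k) (hm : 1 ≤ m) :
    ∃ D : Set (ℝ × ℝ), D.Finite ∧ deltaProp e n k m D := by
  classical
  let g : ℕ × ℕ × ℕ → ℝ × ℝ := fun p =>
    (p.1 : ℝ) • e (n - 1) + ((p.2.1 : ℝ) - p.1) • e p.2.2
  let T : Finset (ℝ × ℝ) :=
    (Finset.range (m+1) ×ˢ Finset.range (m+1) ×ˢ Finset.range n).image g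
  obtain ⟨D, hD, h⟩ := gallai_finitary T k
  refine ⟨D, hD, fun f => ?_⟩
  obtain ⟨r, hr, b, c, hc⟩ := h f
  have hr' : (0 : ℝ) < r := by exact_mod_cast hr
  have key : ∀ i j t : ℕ, i < j → j ≤ m → t < n →
      b + ((r : ℝ) * i) • e (n - 1) + ((r : ℝ) * j - r * i) • e t ∈ D ∧
      f (b + ((r : ℝ) * i) • e (n - 1) + ((r : ℝ) * j - r * i) • e t) = c := by
    intro i j t hij hj ht
    have hmem : g (i, j, t) ∈ T := by
      apply Finset.mem_image_of_mem
      simp only [Finset.mem_product, Finset.mem_range]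
      omega
    have heq : b + ((r : ℝ) * i) • e (n - 1) + ((r : ℝ) * j - r * i) • e t
        = r • g (i, j, t) + b := by
      rw [← Nat.cast_smul_eq_nsmul ℝ]
      simp only [g]
      module
    rw [heq]
    exact hc _ hmem
  refine ⟨b, fun i => r * i, by simp, ?_, ?_⟩
  · intro i _
    push_cast
    nlinarith
  · intro i j hij hj
    refine ⟨?_, ?_⟩
    · rintro _ ⟨_, ⟨t, ht, rfl⟩, rfl⟩
      exact (key i j t hij hj ht).1
    · rintro _ ⟨t, ht, rfl⟩ _ ⟨u, hu, rfl⟩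
      simp only [Set.mem_setOf_eq] at ht hu
      exact (key i j t hij hj (by omega)).2.trans (key i j u hij hj (by omega)).2.symm
end
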